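/- arXiv:2510.09562 — 2 statements merged into one kernel-verified Lean document; each statement's English description precedes it below -/
import Mathlib

section
/- On a probability space, let X₁, X₂, … be nonnegative random variables with common survival function P(Xᵢ > x) = x^{-α} l(x) for all x > 0, where α > 0 and l is slowly varying at infinity. Suppose the sequence is m-dependent for some nonnegative integer m, i.e., for every positive integer k the family (Xᵢ)_{i ≤ k} is independent of the family (Xᵢ)_{i ≥ k+m+1}. Then for every p > α, Condition A(p) holds: ∑_{1≤i,j≤n, i≠j} Cov(X̌ᵢ^p, X̌ⱼ^p) / (v_n^{2p} · c_n²) → 0 as n → ∞. -/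
open MeasureTheory Filter

noncomputable section

/-- `l` is slowly varying at infinity: for every `lam > 0`, `l(lam*x)/l(x) → 1` as `x → ∞`. -/
def SlowlyVarying (l : ℝ → ℝ) : Prop :=
  ∀ lam : ℝ, 0 < lam → Tendsto (fun x => l (lam * x) / l x) atTop (nhds 1)

/-- Covariance `Cov(U,V) = E[UV] - E[U]E[V]`. -/
def cov {Ω : Type*} [MeasurableSpace Ω] (μ : Measure Ω) (U V : Ω → ℝ) : ℝ :=
  (∫ ω, U ω * V ω ∂μ) - (∫ ω, U ω ∂μ) * (∫ ω, V ω ∂μ)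

/-- Truncation `X·1(X < t)`. -/
def trunc {Ω : Type*} (X : Ω → ℝ) (t : ℝ) : Ω → ℝ :=
  fun ω => if X ω < t then X ω else 0

/-- Sum of covariances of `p`-th powers of the variables truncated at `v n`,
over distinct pairs of indices among the first `n`. -/
def covSum {Ω : Type*} [MeasurableSpace Ω] (μ : Measure Ω) (X : ℕ → Ω → ℝ)
    (v : ℕ → ℝ) (p : ℝ) (n : ℕ) : ℝ :=
  ∑ i ∈ Finset.range n, ∑ j ∈ Finset.range n,
    if i = j then 0
    else cov μ (fun ω => trunc (X i) (v n) ω ^ p) (fun ω => trunc (X j) (v n) ω ^ p)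

/-- Condition A(p). -/
def ConditionA {Ω : Type*} [MeasurableSpace Ω] (μ : Measure Ω) (X : ℕ → Ω → ℝ)
    (v c : ℕ → ℝ) (p : ℝ) : Prop :=
  Tendsto (fun n => covSum μ X v p n / (v n ^ (2 * p) * c n ^ 2)) atTop (nhds 0)

/-- `p`-th sample moment `M_{n,p}`. -/
def sampleMoment {Ω : Type*} (X : ℕ → Ω → ℝ) (p : ℝ) (n : ℕ) (ω : Ω) : ℝ :=
  (n : ℝ)⁻¹ * ∑ i ∈ Finset.range n, X i ω ^ p

/-- `Y_n = O_p(r_n)`. -/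
def IsOp {Ω : Type*} [MeasurableSpace Ω] (μ : Measure Ω) (Y : ℕ → Ω → ℝ) (r : ℕ → ℝ) : Prop :=
  ∀ ε : ℝ, 0 < ε → ∃ C : ℝ, 0 < C ∧
    ∀ᶠ n in atTop, (μ {ω | C * r n < |Y n ω|}).toReal < ε

/-- Convergence in probability to a constant. -/
def TendstoInProbability {Ω : Type*} [MeasurableSpace Ω] (μ : Measure Ω)
    (Y : ℕ → Ω → ℝ) (a : ℝ) : Prop :=
  ∀ ε : ℝ, 0 < ε → Tendsto (fun n => (μ {ω | ε < |Y n ω - a|}).toReal) atTop (nhds 0)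

lemma karamata_aux (g : ℝ → ℝ) (q r x0 : ℝ) (hq : 0 < q) (hx0 : 0 < x0) (hr : 0 < r)
    (hrq : r < 2 ^ q) (hgpos : ∀ x, 0 < x → 0 < g x)
    (hanti : ∀ x y, 0 < x → x ≤ y → g y ≤ g x)
    (hg : ∀ x, x0 ≤ x → g (x / 2) ≤ r * g x) :
    ∃ C : ℝ, 0 < C ∧ ∀ T : ℝ → ℝ, (∀ v, 0 < v → T v ≤ v ^ q) →
      (∀ v, 0 < v → T v ≤ T (v / 2) + v ^ q * g (v / 4)) →
      ∀ v, x0 ≤ v → T v ≤ C * (v ^ q * g v) := by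
  have h2q : (0:ℝ) < 2 ^ q := by positivity
  set s : ℝ := r / 2 ^ q with hs
  have hs1 : s < 1 := (div_lt_one h2q).2 hrq
  set A : ℝ := r ^ 2 / (1 - s) with hA
  set B : ℝ := (4 * x0) ^ q / (x0 ^ q * g (4 * x0)) with hB
  have hg4 : 0 < g (4 * x0) := hgpos _ (by positivity)
  have hApos : 0 < A := div_pos (by positivity) (by linarith)
  refine ⟨max A B, lt_of_lt_of_le hApos (le_max_left _ _), ?_⟩
  intro T hT1 hT2
  set C := max A B with hC
  have hCpos : 0 < C := lt_of_lt_of_le hApos (le_max_left _ _)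
  have base : ∀ v, x0 ≤ v → v ≤ 4 * x0 → T v ≤ C * (v ^ q * g v) := by
    intro v h1 h2
    have hv : 0 < v := by linarith
    have e1 : T v ≤ (4 * x0) ^ q :=
      (hT1 v hv).trans (Real.rpow_le_rpow hv.le h2 hq.le)
    have e2 : x0 ^ q * g (4 * x0) ≤ v ^ q * g v :=
      mul_le_mul (Real.rpow_le_rpow hx0.le h1 hq.le) (hanti _ _ hv h2) hg4.le (by positivity)
    have hp : 0 < x0 ^ q * g (4 * x0) := by positivity
    have e3 : (4 * x0) ^ q = B * (x0 ^ q * g (4 * x0)) := by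
      rw [hB, div_mul_cancel₀ _ hp.ne']
    calc T v ≤ B * (x0 ^ q * g (4 * x0)) := by rw [← e3]; exact e1
      _ ≤ C * (v ^ q * g v) := mul_le_mul (le_max_right _ _) e2 hp.le hCpos.le
  have hAC : s * C + r ^ 2 ≤ C := by
    have h1 : A ≤ C := le_max_left _ _
    have h2 : A * (1 - s) = r ^ 2 := div_mul_cancel₀ _ (by linarith)
    nlinarith
  have main : ∀ N : ℕ, ∀ v, x0 ≤ v → v ≤ 2 ^ N * x0 → T v ≤ C * (v ^ q * g v) := by
    intro N
    induction N with
    | zero => intro v h1 h2; exact base v h1 (by simp at h2; linarith)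
    | succ N ih =>
      intro v h1 h2
      by_cases h4 : v ≤ 4 * x0
      · exact base v h1 h4
      push Not at h4
      have hv : 0 < v := by linarith
      have i1 := ih (v / 2) (by linarith) (by rw [pow_succ] at h2; linarith)
      have i2 := hT2 v hv
      have g1 := hg v h1
      have g2 := hg (v / 2) (by linarith)
      rw [show v / 2 / 2 = v / 4 by ring] at g2
      have gv := hgpos v hv
      have hvq : 0 < v ^ q := by positivity
      have g3 : g (v / 4) ≤ r ^ 2 * g v := by nlinarith
      have e : (v / 2) ^ q * g (v / 2) ≤ s * (v ^ q * g v) := by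
        rw [Real.div_rpow hv.le (by norm_num), hs]
        calc v ^ q / 2 ^ q * g (v / 2) ≤ v ^ q / 2 ^ q * (r * g v) := by gcongr
          _ = _ := by ring
      calc T v ≤ T (v / 2) + v ^ q * g (v / 4) := i2
        _ ≤ C * (s * (v ^ q * g v)) + v ^ q * (r ^ 2 * g v) := by
          gcongr
          exact i1.trans (by gcongr)
        _ = (s * C + r ^ 2) * (v ^ q * g v) := by ring
        _ ≤ C * (v ^ q * g v) := by gcongr
  intro v hv
  obtain ⟨N, hN⟩ := pow_unbounded_of_one_lt (v / x0) (one_lt_two)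
  exact main N v hv ((div_le_iff₀ hx0).1 hN.le)

lemma trunc_meas {Ω : Type*} [MeasurableSpace Ω] {X : Ω → ℝ} (hX : Measurable X) (t : ℝ) :
    Measurable (trunc X t) :=
  Measurable.ite (measurableSet_lt hX measurable_const) hX measurable_const

lemma trunc_nn {Ω : Type*} {X : Ω → ℝ} (hX : ∀ ω, 0 ≤ X ω) (t : ℝ) (ω : Ω) :
    0 ≤ trunc X t ω := by
  unfold trunc; split_ifs; exacts [hX ω, le_rfl]

lemma trunc_le {Ω : Type*} {X : Ω → ℝ} (t : ℝ) (ht : 0 < t) (ω : Ω) :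
    trunc X t ω ≤ t := by
  unfold trunc; split_ifs with h; exacts [h.le, ht.le]

lemma trunc_int {Ω : Type*} [MeasurableSpace Ω] (μ : Measure Ω) [IsProbabilityMeasure μ]
    {X : Ω → ℝ} (hX : Measurable X) (hnn : ∀ ω, 0 ≤ X ω) (t : ℝ) (ht : 0 < t) (q : ℝ)
    (hq : 0 < q) : Integrable (fun ω => trunc X t ω ^ q) μ := by
  refine Integrable.of_bound ((trunc_meas hX t).pow_const q).aestronglyMeasurable (t ^ q) ?_
  refine Eventually.of_forall fun ω => ?_
  have h := trunc_nn hnn t ω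
  rw [Real.norm_of_nonneg (by positivity)]
  exact Real.rpow_le_rpow h (trunc_le t ht ω) hq.le

lemma T_bound {Ω : Type*} [MeasurableSpace Ω] (μ : Measure Ω) [IsProbabilityMeasure μ]
    {X : Ω → ℝ} (hX : Measurable X) (hnn : ∀ ω, 0 ≤ X ω) (t : ℝ) (ht : 0 < t) (q : ℝ)
    (hq : 0 < q) : ∫ ω, trunc X t ω ^ q ∂μ ≤ t ^ q := by
  calc ∫ ω, trunc X t ω ^ q ∂μ ≤ ∫ ω, t ^ q ∂μ := by
        refine integral_mono (trunc_int μ hX hnn t ht q hq) (integrable_const _) fun ω => ?_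
        exact Real.rpow_le_rpow (trunc_nn hnn t ω) (trunc_le t ht ω) hq.le
    _ = t ^ q := by simp

lemma T_rec {Ω : Type*} [MeasurableSpace Ω] (μ : Measure Ω) [IsProbabilityMeasure μ]
    {X : Ω → ℝ} (hX : Measurable X) (hnn : ∀ ω, 0 ≤ X ω) (t : ℝ) (ht : 0 < t) (q : ℝ)
    (hq : 0 < q) : ∫ ω, trunc X t ω ^ q ∂μ ≤
      ∫ ω, trunc X (t / 2) ω ^ q ∂μ + t ^ q * (μ {ω | t / 4 < X ω}).toReal := by
  have hS : MeasurableSet {ω | t / 4 < X ω} := measurableSet_lt measurable_const hX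
  have hi2 : Integrable ({ω | t / 4 < X ω}.indicator (fun _ => t ^ q)) μ :=
    (integrable_const _).indicator hS
  have hi1 := trunc_int μ hX hnn (t / 2) (by linarith) q hq
  have e : t ^ q * (μ {ω | t / 4 < X ω}).toReal =
      ∫ ω, ({ω | t / 4 < X ω}.indicator (fun _ => t ^ q)) ω ∂μ := by
    rw [integral_indicator_const _ hS]; simp [Measure.real, mul_comm]
  rw [e, ← integral_add hi1 hi2]
  refine integral_mono (trunc_int μ hX hnn t ht q hq) (hi1.add hi2) fun ω => ?_
  by_cases h : X ω < t / 2
  · have h' : X ω < t := by linarith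
    have : 0 ≤ ({ω | t / 4 < X ω}.indicator (fun _ => t ^ q)) ω :=
      Set.indicator_nonneg (fun _ _ => by positivity) _
    simp only [trunc, h, h', if_true, Pi.add_apply]
    linarith
  · have hm : ω ∈ {ω | t / 4 < X ω} := by simp only [Set.mem_setOf_eq]; linarith
    have := Real.rpow_nonneg (trunc_nn hnn (t / 2) ω) q
    have h3 := Real.rpow_le_rpow (trunc_nn hnn t ω) (trunc_le t ht ω) hq.le
    simp only [Set.indicator_of_mem hm]
    linarith

lemma cov_bound {Ω : Type*} [MeasurableSpace Ω] (μ : Measure Ω) [IsProbabilityMeasure μ]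
    {X Y : Ω → ℝ} (hX : Measurable X) (hnn : ∀ ω, 0 ≤ X ω) (hY : Measurable Y)
    (hnnY : ∀ ω, 0 ≤ Y ω) (t : ℝ) (ht : 0 < t) (p : ℝ)
    (hp : 0 < p) (B : ℝ) (hBX : ∫ ω, trunc X t ω ^ (2 * p) ∂μ ≤ B)
    (hBY : ∫ ω, trunc Y t ω ^ (2 * p) ∂μ ≤ B) :
    |cov μ (fun ω => trunc X t ω ^ p) (fun ω => trunc Y t ω ^ p)| ≤ B := by
  have sq : ∀ {Z : Ω → ℝ}, (∀ ω, 0 ≤ Z ω) → ∀ ω, trunc Z t ω ^ (2 * p) = (trunc Z t ω ^ p) ^ 2 := by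
    intro Z hZ ω
    rw [mul_comm, Real.rpow_mul (trunc_nn hZ t ω)]; norm_cast
  have iX := trunc_int μ hX hnn t ht (2 * p) (by linarith)
  have iY := trunc_int μ hY hnnY t ht (2 * p) (by linarith)
  have jX := trunc_int μ hX hnn t ht p hp
  have jY := trunc_int μ hY hnnY t ht p hp
  have pX : ∀ ω, 0 ≤ trunc X t ω ^ p := fun ω => Real.rpow_nonneg (trunc_nn hnn t ω) p
  have pY : ∀ ω, 0 ≤ trunc Y t ω ^ p := fun ω => Real.rpow_nonneg (trunc_nn hnnY t ω) p
  simp_rw [sq hnn] at hBX iX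
  simp_rw [sq hnnY] at hBY iY
  unfold cov
  beta_reduce
  have key : ∀ (W : Ω → ℝ), Integrable W μ → Integrable (fun ω => W ω ^ 2) μ →
      (∫ ω, W ω ∂μ) ^ 2 ≤ ∫ ω, W ω ^ 2 ∂μ := by
    intro W h1 h2
    set a := ∫ ω, W ω ∂μ with ha
    have h3 : 0 ≤ ∫ ω, (W ω - a) ^ 2 ∂μ := integral_nonneg fun ω => sq_nonneg _
    have h4 : ∫ ω, (W ω - a) ^ 2 ∂μ = ∫ ω, W ω ^ 2 ∂μ - 2 * a * a + a ^ 2 := by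
      have : ∀ ω, (W ω - a) ^ 2 = W ω ^ 2 - 2 * a * W ω + a ^ 2 := fun ω => by ring
      simp_rw [this]
      have i3 : Integrable (fun ω => 2 * a * W ω) μ := h1.const_mul _
      have i4 : Integrable (fun ω => W ω ^ 2 - 2 * a * W ω) μ := h2.sub i3
      rw [integral_add i4 (integrable_const _), integral_sub h2 i3, integral_const_mul]
      simp [← ha]
    nlinarith
  have kX := key _ jX iX
  have kY := key _ jY iY
  have nX : 0 ≤ ∫ ω, trunc X t ω ^ p ∂μ := integral_nonneg pX
  have nY : 0 ≤ ∫ ω, trunc Y t ω ^ p ∂μ := integral_nonneg pY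
  have nXY : 0 ≤ ∫ ω, trunc X t ω ^ p * trunc Y t ω ^ p ∂μ :=
    integral_nonneg fun ω => mul_nonneg (pX ω) (pY ω)
  have uXY : ∫ ω, trunc X t ω ^ p * trunc Y t ω ^ p ∂μ ≤
      (∫ ω, (trunc X t ω ^ p) ^ 2 ∂μ + ∫ ω, (trunc Y t ω ^ p) ^ 2 ∂μ) / 2 := by
    rw [← integral_add iX iY, ← integral_div]
    refine integral_mono_of_nonneg (Eventually.of_forall fun ω => mul_nonneg (pX ω) (pY ω))
      ((iX.add iY).div_const 2) (Eventually.of_forall fun ω => ?_)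
    have := two_mul_le_add_sq (trunc X t ω ^ p) (trunc Y t ω ^ p)
    simp only []
    linarith
  have := two_mul_le_add_sq (∫ ω, trunc X t ω ^ p ∂μ) (∫ ω, trunc Y t ω ^ p ∂μ)
  have := mul_nonneg nX nY
  rw [abs_le]
  constructor <;> linarith

lemma cov_zero {Ω : Type*} [MeasurableSpace Ω] (μ : Measure Ω) [IsProbabilityMeasure μ]
    {X Y : Ω → ℝ} (hX : Measurable X) (hY : Measurable Y)
    (h : ProbabilityTheory.IndepFun X Y μ) (t p : ℝ) :
    cov μ (fun ω => trunc X t ω ^ p) (fun ω => trunc Y t ω ^ p) = 0 := by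
  have hφ : Measurable (fun x : ℝ => (if x < t then x else 0) ^ p) :=
    (Measurable.ite measurableSet_Iio measurable_id measurable_const).pow_const p
  have h' := h.comp hφ hφ
  unfold cov
  rw [sub_eq_zero]
  exact h'.integral_mul_eq_mul_integral (hφ.comp hX).aestronglyMeasurable
    (hφ.comp hY).aestronglyMeasurable

/-- **Theorem (m-dependence implies Condition A(p)).**
If the nonnegative random variables `X₀, X₁, …` have common survival function
`P(Xᵢ > x) = x^(-α) l(x)` with `l` slowly varying and `α > 0`, and the sequence is
`m`-dependent, then Condition A(p) holds for every `p > α`. -/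
theorem m_dependent_conditionA
    {Ω : Type*} [MeasurableSpace Ω] (μ : Measure Ω) [IsProbabilityMeasure μ]
    (X : ℕ → Ω → ℝ) (hXmeas : ∀ i, Measurable (X i)) (hXnn : ∀ i ω, 0 ≤ X i ω)
    (α : ℝ) (hα : 0 < α)
    (l : ℝ → ℝ) (hlpos : ∀ x : ℝ, 0 < x → 0 < l x) (hl : SlowlyVarying l)
    (hsurv : ∀ i, ∀ x : ℝ, 0 < x → (μ {ω | x < X i ω}).toReal = x ^ (-α) * l x)
    (c : ℕ → ℝ) (hc : ∀ n, 0 < c n) (hctop : Tendsto c atTop atTop)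
    (hncmono : Monotone fun n : ℕ => (n : ℝ) * c n)
    (hnctop : Tendsto (fun n : ℕ => (n : ℝ) * c n) atTop atTop)
    (hclog : Tendsto (fun n : ℕ => Real.log (c n) / Real.log n) atTop (nhds 0))
    (v : ℕ → ℝ) (hvpos : ∀ n, 0 < v n)
    (hv : Tendsto (fun n : ℕ => (n : ℝ) * l (v n) / (v n ^ α * c n)) atTop (nhds 1))
    (m : ℕ)
    (hdep : ∀ k : ℕ, ProbabilityTheory.Indep
      (⨆ i ∈ {i : ℕ | i ≤ k}, MeasurableSpace.comap (X i) inferInstance)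
      (⨆ i ∈ {i : ℕ | k + m + 1 ≤ i}, MeasurableSpace.comap (X i) inferInstance) μ) :
    ∀ p : ℝ, α < p → ConditionA μ X v c p := by
  intro p hp
  have hp0 : 0 < p := hα.trans hp
  set g : ℝ → ℝ := fun x => x ^ (-α) * l x with hgdef
  have hgpos : ∀ x, 0 < x → 0 < g x := fun x hx => mul_pos (Real.rpow_pos_of_pos hx _) (hlpos x hx)
  have hanti : ∀ x y, 0 < x → x ≤ y → g y ≤ g x := by
    intro x y hx hxy
    have h1 := hsurv 0 x hx
    have h2 := hsurv 0 y (hx.trans_le hxy)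
    simp only [hgdef]
    rw [← h1, ← h2]
    refine ENNReal.toReal_mono (measure_ne_top _ _) (measure_mono fun ω hω => ?_)
    exact lt_of_le_of_lt hxy hω
  have h2lt : (2:ℝ) ^ α < 2 ^ (2 * p) := Real.rpow_lt_rpow_of_exponent_lt (by norm_num) (by linarith)
  obtain ⟨r, hr1, hr2⟩ := exists_between h2lt
  have hr0 : 0 < r := lt_trans (by positivity) hr1
  have hlim : Tendsto (fun x => (2:ℝ) ^ α * (l (2⁻¹ * x) / l x)) atTop (nhds (2 ^ α * 1)) :=
    (hl 2⁻¹ (by norm_num)).const_mul _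
  rw [mul_one] at hlim
  obtain ⟨x1, hx1⟩ := eventually_atTop.1 (hlim.eventually (gt_mem_nhds hr1))
  have hgr : ∀ x, max x1 1 ≤ x → g (x / 2) ≤ r * g x := by
    intro x hx
    have hxp : 0 < x := lt_of_lt_of_le one_pos ((le_max_right _ _).trans hx)
    have h := hx1 x ((le_max_left _ _).trans hx)
    have hlx := hlpos x hxp
    rw [← mul_div_assoc, div_lt_iff₀ hlx] at h
    simp only [hgdef]
    rw [Real.div_rpow hxp.le (by norm_num), Real.rpow_neg (by norm_num : (0:ℝ) ≤ 2),
      div_inv_eq_mul, show x / 2 = 2⁻¹ * x by ring]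
    have : 0 < x ^ (-α) := by positivity
    nlinarith
  obtain ⟨C, hC, hK⟩ := karamata_aux g (2 * p) r (max x1 1) (by linarith)
    (lt_of_lt_of_le one_pos (le_max_right _ _)) hr0 hr2 hgpos hanti hgr
  have hT : ∀ i, ∀ t, max x1 1 ≤ t →
      ∫ ω, trunc (X i) t ω ^ (2 * p) ∂μ ≤ C * (t ^ (2 * p) * g t) := by
    intro i
    refine hK (fun t => ∫ ω, trunc (X i) t ω ^ (2 * p) ∂μ)
      (fun t ht => T_bound μ (hXmeas i) (hXnn i) t ht _ (by linarith)) fun t ht => ?_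
    have := T_rec μ (hXmeas i) (hXnn i) t ht (2 * p) (by linarith)
    rwa [hsurv i (t / 4) (by linarith)] at this
  -- n g(v n) / c n → 1
  have hv' : Tendsto (fun n : ℕ => (n : ℝ) * g (v n) / c n) atTop (nhds 1) := by
    refine hv.congr fun n => ?_
    simp only [hgdef]
    rw [Real.rpow_neg (hvpos n).le]
    have := hc n
    have := Real.rpow_pos_of_pos (hvpos n) α
    field_simp
  have hcn : Tendsto (fun n : ℕ => c n / n) atTop (nhds 0) := by
    have hs : Tendsto (fun n : ℕ => (n : ℝ) ^ (-(1/2) : ℝ)) atTop (nhds 0) :=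
      (tendsto_rpow_neg_atTop (by norm_num)).comp tendsto_natCast_atTop_atTop
    refine tendsto_of_tendsto_of_tendsto_of_le_of_le' tendsto_const_nhds hs
      (Eventually.of_forall fun n => div_nonneg (hc n).le (Nat.cast_nonneg n)) ?_
    filter_upwards [hclog.eventually (gt_mem_nhds (by norm_num : (0:ℝ) < 1/2)),
      eventually_ge_atTop 2] with n h1 h2
    have hn : (1:ℝ) < n := by exact_mod_cast h2
    have hn0 : (0:ℝ) < n := by linarith
    rw [div_lt_iff₀ (Real.log_pos hn)] at h1
    have h3 : c n ≤ (n:ℝ) ^ (1/2 : ℝ) := by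
      rw [← Real.log_le_log_iff (hc n) (by positivity), Real.log_rpow hn0]
      exact h1.le
    rw [div_le_iff₀ hn0]
    refine h3.trans (le_of_eq ?_)
    nth_rewrite 3 [← Real.rpow_one (n:ℝ)]
    rw [← Real.rpow_add hn0]; norm_num
  have hg0 : Tendsto (fun n : ℕ => g (v n)) atTop (nhds 0) := by
    have := hv'.mul hcn
    rw [mul_zero] at this
    refine this.congr' ?_
    filter_upwards [eventually_ge_atTop 1] with n hn
    have : (0:ℝ) < n := by exact_mod_cast hn
    have := hc n
    field_simp
  have hvlarge : ∀ᶠ n in atTop, max x1 1 ≤ v n := by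
    have hM : 0 < max x1 1 := lt_of_lt_of_le one_pos (le_max_right _ _)
    filter_upwards [hg0.eventually (gt_mem_nhds (hgpos _ hM))] with n hn
    by_contra! hlt
    exact absurd (hanti _ _ (hvpos n) hlt.le) (not_le.2 hn)
  have hind : ∀ i j, i + m + 1 ≤ j → ProbabilityTheory.IndepFun (X i) (X j) μ := by
    intro i j hij
    rw [ProbabilityTheory.IndepFun_iff_Indep]
    refine ProbabilityTheory.indep_of_indep_of_le_left
      (ProbabilityTheory.indep_of_indep_of_le_right (hdep i) ?_) ?_
    · exact le_iSup₂_of_le (f := fun k (_ : k ∈ {k : ℕ | i + m + 1 ≤ k}) =>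
        MeasurableSpace.comap (X k) inferInstance) j hij le_rfl
    · exact le_iSup₂_of_le (f := fun k (_ : k ∈ {k : ℕ | k ≤ i}) =>
        MeasurableSpace.comap (X k) inferInstance) i (le_refl i) le_rfl
  have hcs : ∀ᶠ n in atTop, |covSum μ X v p n| ≤
      n * ((2 * m + 1) * (C * (v n ^ (2 * p) * g (v n)))) := by
    filter_upwards [hvlarge] with n hn
    set B := C * (v n ^ (2 * p) * g (v n)) with hB
    have hB0 : 0 ≤ B := by
      have := hgpos _ (hvpos n)
      have := Real.rpow_pos_of_pos (hvpos n) (2 * p)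
      positivity
    unfold covSum
    refine (Finset.abs_sum_le_sum_abs _ _).trans ?_
    refine (Finset.sum_le_card_nsmul _ _ ((2 * m + 1) * B) fun i _ => ?_).trans (by simp)
    refine (Finset.abs_sum_le_sum_abs _ _).trans ?_
    have h1 : ∀ j ∈ Finset.range n, |if i = j then 0
        else cov μ (fun ω => trunc (X i) (v n) ω ^ p) (fun ω => trunc (X j) (v n) ω ^ p)| ≤
        if j ∈ Finset.Icc (i - m) (i + m) then B else 0 := by
      intro j _
      by_cases hj : j ∈ Finset.Icc (i - m) (i + m)
      · rw [if_pos hj]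
        split_ifs
        · simpa using hB0
        · exact cov_bound μ (hXmeas i) (hXnn i) (hXmeas j) (hXnn j) (v n) (hvpos n) p hp0 B
            (hT i _ hn) (hT j _ hn)
      · rw [if_neg hj]
        split_ifs
        · simp
        · have hI : ProbabilityTheory.IndepFun (X i) (X j) μ := by
            simp only [Finset.mem_Icc, not_and_or, not_le] at hj
            rcases hj with hj | hj
            · exact (hind j i (by omega)).symm
            · exact hind i j (by omega)
          rw [cov_zero μ (hXmeas i) (hXmeas j) hI]; simp
    refine (Finset.sum_le_sum h1).trans ?_
    rw [← Finset.sum_filter, Finset.sum_const, nsmul_eq_mul]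
    refine mul_le_mul_of_nonneg_right ?_ hB0
    have h2 : (Finset.filter (fun j => j ∈ Finset.Icc (i - m) (i + m)) (Finset.range n)).card
        ≤ 2 * m + 1 := by
      refine (Finset.card_le_card (t := Finset.Icc (i - m) (i + m)) fun j hj =>
        (Finset.mem_filter.1 hj).2).trans ?_
      rw [Nat.card_Icc]; omega
    exact_mod_cast h2
  have hfin : Tendsto (fun n : ℕ => (2 * m + 1) * C * ((n : ℝ) * g (v n) / c n * (c n)⁻¹))
      atTop (nhds 0) := by
    have := (hv'.mul (tendsto_inv_atTop_zero.comp hctop)).const_mul ((2 * m + 1) * C)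
    simpa using this
  unfold ConditionA
  refine squeeze_zero_norm' ?_ hfin
  filter_upwards [hcs] with n hn
  have hvp := Real.rpow_pos_of_pos (hvpos n) (2 * p)
  have hcp := hc n
  rw [Real.norm_eq_abs, abs_div, abs_of_pos (mul_pos hvp (pow_pos hcp 2)),
    div_le_iff₀ (mul_pos hvp (pow_pos hcp 2))]
  refine hn.trans (le_of_eq ?_)
  field_simp
end
end

section
/- On a probability space, let X₁, X₂, … be nonnegative random variables with common survival function P(Xᵢ > x) = x^{-α} l(x) for all x > 0, where α > 0 and l is slowly varying at infinity. Let p > α and suppose Condition A(p) holds. Then log M_{n,p}/log n − (p−α)/α = O_p((log c_n + |log l(t_n)|)/log n), and consequently log M_{n,p}/log n →p (p−α)/α as n → ∞. -/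
open MeasureTheory Filter

noncomputable section

lemma aux_doubling (P : ℝ → Prop) (x0 : ℝ) (hx0 : 0 < x0)
    (base : ∀ x, x0 ≤ x → x ≤ 2 * x0 → P x) (step : ∀ x, x0 ≤ x → P x → P (2 * x)) :
    ∀ x, x0 ≤ x → P x := by
  have key : ∀ k : ℕ, ∀ x, x0 ≤ x → x ≤ 2 ^ (k + 1) * x0 → P x := by
    intro k
    induction k with
    | zero => intro x h1 h2; exact base x h1 (by simpa using h2)
    | succ k ih =>
      intro x h1 h2
      by_cases h : x ≤ 2 * x0
      · exact base x h1 h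
      · push Not at h
        have := step (x / 2) (by linarith) (ih (x / 2) (by linarith) (by
          rw [pow_succ] at h2; linarith))
        rwa [show 2 * (x / 2) = x by ring] at this
  intro x hx
  obtain ⟨k, hk⟩ := pow_unbounded_of_one_lt (x / x0) (one_lt_two)
  refine key k x hx ?_
  rw [div_lt_iff₀ hx0] at hk
  have : (0:ℝ) < 2 ^ k * x0 := by positivity
  rw [pow_succ]; linarith

/-- regularly varying, positive, antitone tail -/
structure AuxTail (S : ℝ → ℝ) (α : ℝ) : Prop where
  pos : ∀ x, 0 < x → 0 < S x
  anti : ∀ x y, 0 < x → x ≤ y → S y ≤ S x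
  rv : ∀ lam : ℝ, 0 < lam → Tendsto (fun x => S (lam * x) / S x) atTop (nhds (lam ^ (-α)))

lemma AuxTail.karamata {S : ℝ → ℝ} {α : ℝ} (hS : AuxTail S α) (hα : 0 < α) {p : ℝ} (hp : α < p)
    {Ω : Type*} [MeasurableSpace Ω] (μ : Measure Ω) [IsProbabilityMeasure μ] :
    ∃ K x0 : ℝ, 0 < K ∧ 0 < x0 ∧ ∀ v, x0 ≤ v → ∀ Y : Ω → ℝ, Measurable Y → (∀ ω, 0 ≤ Y ω) →
      (∀ x, 0 < x → (μ {ω | x < Y ω}).toReal = S x) →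
      ∫ ω, (if Y ω ≤ v then Y ω ^ p else 0) ∂μ ≤ K * (v ^ p * S v) := by
  have h1 : (2:ℝ) ^ (-((α + p) / 2)) < 2 ^ (-α) :=
    Real.rpow_lt_rpow_of_exponent_lt one_lt_two (by linarith)
  have h2 : (2:ℝ) ^ (-p) < 2 ^ (-((α + p) / 2)) :=
    Real.rpow_lt_rpow_of_exponent_lt one_lt_two (by linarith)
  set q := (2:ℝ) ^ (-((α + p) / 2)) with hq
  have h3 := (hS.rv 2 two_pos).eventually (lt_mem_nhds h1)
  obtain ⟨y0, hy0⟩ := eventually_atTop.1 h3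
  set x0 := max y0 1 with hx0
  have hx0p : 0 < x0 := lt_of_lt_of_le one_pos (le_max_right _ _)
  have hS2 := hS.pos (2 * x0) (by linarith)
  set K := max (1 / (q - 2 ^ (-p))) ((2 * x0) ^ p / (x0 ^ p * S (2 * x0))) with hK
  have hKp : 0 < K := lt_of_lt_of_le (by have := sub_pos.2 h2; positivity) (le_max_left _ _)
  have hp0 : 0 < p := by linarith
  have hint : ∀ (Y : Ω → ℝ), Measurable Y → (∀ ω, 0 ≤ Y ω) → ∀ v, 0 < v →
      Integrable (fun ω => if Y ω ≤ v then Y ω ^ p else 0) μ := by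
    intro Y hY hYn v hv
    refine Integrable.of_bound (C := v ^ p) ?_ ?_
    · exact (Measurable.ite (measurableSet_le hY measurable_const) (hY.pow_const p)
        measurable_const).aestronglyMeasurable
    · refine Eventually.of_forall fun ω => ?_
      have := hYn ω
      split_ifs with h
      · rw [Real.norm_of_nonneg (by positivity)]
        exact Real.rpow_le_rpow (hYn ω) h hp0.le
      · simp; positivity
  refine ⟨K, x0, hKp, hx0p, ?_⟩
  refine aux_doubling _ x0 hx0p ?_ ?_
  · intro v hv1 hv2 Y hY hYn hYs
    have hvp : 0 < v := by linarith
    have e1 : ∫ ω, (if Y ω ≤ v then Y ω ^ p else 0) ∂μ ≤ ∫ ω, (2 * x0) ^ p ∂μ := by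
      apply integral_mono (hint Y hY hYn v hvp) (integrable_const _)
      intro ω
      have := hYn ω
      dsimp only
      split_ifs with h
      · exact Real.rpow_le_rpow (hYn ω) (by linarith) hp0.le
      · positivity
    simp only [integral_const, probReal_univ, smul_eq_mul, one_mul] at e1
    refine e1.trans ?_
    have e2 : (2 * x0) ^ p = (2 * x0) ^ p / (x0 ^ p * S (2 * x0)) * (x0 ^ p * S (2 * x0)) := by
      field_simp
    rw [e2]
    have e3 : x0 ^ p ≤ v ^ p := Real.rpow_le_rpow hx0p.le hv1 hp0.le
    have e4 := hS.anti v (2 * x0) hvp hv2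
    have e5 : (0:ℝ) < v ^ p := by positivity
    apply mul_le_mul (le_max_right _ _) _ (by positivity) hKp.le
    exact mul_le_mul e3 e4 hS2.le e5.le
  · intro v hv ih Y hY hYn hYs
    have hvp : 0 < v := by linarith
    have hms : MeasurableSet {ω | v < Y ω} := measurableSet_lt measurable_const hY
    have e1 : ∫ ω, (if Y ω ≤ 2 * v then Y ω ^ p else 0) ∂μ ≤
        ∫ ω, ((if Y ω ≤ v then Y ω ^ p else 0)
          + Set.indicator {ω | v < Y ω} (fun _ => (2 * v) ^ p) ω) ∂μ := by
      apply integral_mono (hint Y hY hYn _ (by linarith))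
      · exact (hint Y hY hYn v hvp).add ((integrable_const _).indicator hms)
      intro ω
      have := hYn ω
      dsimp only [Set.indicator, Set.mem_setOf_eq]
      have hpw : Y ω ≤ 2 * v → Y ω ^ p ≤ (2 * v) ^ p := fun h =>
        Real.rpow_le_rpow (hYn ω) h hp0.le
      have hpp : 0 ≤ (2 * v) ^ p := by positivity
      split_ifs with ha hb hc hc hb hc hc
      all_goals first | linarith | (have := hpw ha; linarith) | exact absurd (not_le.1 hb) hc
    rw [integral_add (hint Y hY hYn v hvp) ((integrable_const _).indicator hms),
      integral_indicator_const _ hms] at e1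
    have e2 := ih Y hY hYn hYs
    have e3 : μ.real {ω | v < Y ω} = S v := hYs v hvp
    rw [e3, smul_eq_mul] at e1
    have e4 := hy0 v (le_trans (le_max_left _ _) hv)
    have hSv := hS.pos v hvp
    rw [lt_div_iff₀ hSv] at e4
    have e5 : 1 ≤ K * (q - 2 ^ (-p)) := by
      have := le_max_left (1 / (q - 2 ^ (-p))) ((2 * x0) ^ p / (x0 ^ p * S (2 * x0)))
      rw [← hK, div_le_iff₀ (sub_pos.2 h2)] at this
      exact this
    have e6 : v ^ p = 2 ^ (-p) * (2 * v) ^ p := by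
      rw [Real.mul_rpow two_pos.le hvp.le, Real.rpow_neg two_pos.le]
      field_simp
    have hpp : 0 < (2 * v) ^ p := by positivity
    rw [e6] at e2
    have e7 : K * (q * S v) ≤ K * S (2 * v) := by nlinarith
    have e8 : S v ≤ S v * (K * (q - 2 ^ (-p))) := by nlinarith
    have e9 : (2 * v) ^ p * (S v + K * 2 ^ (-p) * S v) ≤ (2 * v) ^ p * (K * S (2 * v)) := by
      apply mul_le_mul_of_nonneg_left _ hpp.le
      nlinarith
    nlinarith

/-- slow variation consequence -/
lemma AuxTail.log_tail {S : ℝ → ℝ} {α : ℝ} (hS : AuxTail S α) (hα : 0 < α) :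
    Tendsto (fun x => (Real.log (S x) + α * Real.log x) / Real.log x) atTop (nhds 0) := by
  set g : ℝ → ℝ := fun x => Real.log (S x) + α * Real.log x with hg
  have hstep : Tendsto (fun x => g (2 * x) - g x) atTop (nhds 0) := by
    have h1 := (hS.rv 2 two_pos).log (by positivity)
    rw [Real.log_rpow two_pos] at h1
    have h2 := h1.add_const (α * Real.log 2)
    rw [show -α * Real.log 2 + α * Real.log 2 = 0 by ring] at h2
    refine h2.congr' ?_
    filter_upwards [eventually_gt_atTop 0] with x hx
    simp only [hg]
    rw [Real.log_div (hS.pos _ (by linarith)).ne' (hS.pos _ hx).ne',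
      Real.log_mul two_ne_zero hx.ne']
    ring
  rw [Metric.tendsto_atTop] 
  intro ε hε
  have hl2 : 0 < Real.log 2 := Real.log_pos one_lt_two
  set δ := ε / 2 * Real.log 2 with hδ
  have hδp : 0 < δ := by positivity
  rw [Metric.tendsto_atTop] at hstep
  obtain ⟨y0, hy0⟩ := hstep δ hδp
  set x0 := max y0 1 with hx0
  have hx01 : 1 ≤ x0 := le_max_right _ _
  have hx0p : 0 < x0 := by linarith
  set B := |Real.log (S x0)| + |Real.log (S (2 * x0))| + α * Real.log (2 * x0) with hB
  have hkey : ∀ x, x0 ≤ x → |g x| ≤ B + ε / 2 * Real.log x := by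
    refine aux_doubling _ x0 hx0p ?_ ?_
    · intro x h1 h2
      have hxp : 0 < x := by linarith
      have a1 := Real.log_le_log (hS.pos _ hxp) (hS.anti _ _ hx0p h1)
      have a2 := Real.log_le_log (hS.pos (2 * x0) (by linarith)) (hS.anti _ _ hxp h2)
      have a3 : 0 ≤ Real.log x := Real.log_nonneg (by linarith)
      have a4 := Real.log_le_log hxp h2
      have a5 := mul_le_mul_of_nonneg_left a4 hα.le
      have a6 : 0 ≤ ε / 2 * Real.log x := by positivity
      have a7 : 0 ≤ α * Real.log x := by positivity
      have b1 := le_abs_self (Real.log (S x0))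
      have b2 := neg_abs_le (Real.log (S (2 * x0)))
      have b3 := abs_nonneg (Real.log (S x0))
      have b4 := abs_nonneg (Real.log (S (2 * x0)))
      simp only [hg]
      rw [abs_le]
      constructor <;> linarith
    · intro x h1 ih
      have hxp : 0 < x := by linarith
      have a1 := hy0 x (le_trans (le_max_left _ _) h1)
      rw [Real.dist_eq, sub_zero] at a1
      rw [Real.log_mul two_ne_zero hxp.ne']
      have : g (2 * x) = g x + (g (2 * x) - g x) := by ring
      rw [this]
      have := abs_add_le (g x) (g (2 * x) - g x)
      nlinarith
  have hlim := Real.tendsto_log_atTop.eventually_gt_atTop (2 * |B| / ε)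
  obtain ⟨z0, hz0⟩ := eventually_atTop.1 hlim
  refine ⟨max x0 z0, fun x hx => ?_⟩
  have a1 := hkey x (le_trans (le_max_left _ _) hx)
  have a2 := hz0 x (le_trans (le_max_right _ _) hx)
  have a3 : 0 < Real.log x := lt_of_le_of_lt (by positivity) a2
  rw [Real.dist_eq, sub_zero, abs_div, abs_of_pos a3, div_lt_iff₀ a3]
  rw [div_lt_iff₀ hε] at a2
  have := le_abs_self B
  change |g x| < _
  nlinarith

lemma AuxTail.tendsto_arg {S : ℝ → ℝ} {α : ℝ} (hS : AuxTail S α) (u : ℕ → ℝ) (hu : ∀ n, 0 < u n)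
    (h : Tendsto (fun n => S (u n)) atTop (nhds 0)) : Tendsto u atTop atTop := by
  rw [tendsto_atTop]
  intro b
  have hb : 0 < max b 1 := lt_of_lt_of_le one_pos (le_max_right _ _)
  filter_upwards [h.eventually (gt_mem_nhds (hS.pos _ hb))] with n hn
  by_contra hlt
  push Not at hlt
  have := hS.anti _ _ (hu n) (hlt.le.trans (le_max_left b 1))
  linarith

/-- Potter-type bound -/
lemma AuxTail.potter {S : ℝ → ℝ} {α : ℝ} (hS : AuxTail S α) (hα : 0 < α) :
    ∃ x0 : ℝ, 0 < x0 ∧ ∀ v t A : ℝ, x0 ≤ v → 0 < t → 1 ≤ A → S v ≤ A * S t →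
      Real.log t ≤ Real.log v + 2 / α * Real.log A + 2 * Real.log 2 := by
  have h1 : (2:ℝ) ^ (-α) < 2 ^ (-(α / 2)) :=
    Real.rpow_lt_rpow_of_exponent_lt one_lt_two (by linarith)
  obtain ⟨y0, hy0⟩ := eventually_atTop.1 ((hS.rv 2 two_pos).eventually (gt_mem_nhds h1))
  set x0 := max y0 1 with hx0
  have hx01 : 1 ≤ x0 := le_max_right _ _
  refine ⟨x0, by linarith, ?_⟩
  intro v t A hv ht hA hvt
  have hvp : 0 < v := by linarith
  have hl2 : 0 < Real.log 2 := Real.log_pos one_lt_two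
  have hpow : ∀ k : ℕ, Real.log (S (2 ^ k * v)) ≤ Real.log (S v) - k * (α / 2 * Real.log 2) := by
    intro k
    induction k with
    | zero => simp
    | succ k ih =>
      have hk1 : (1:ℝ) ≤ 2 ^ k := one_le_pow₀ one_le_two
      have hx : x0 ≤ 2 ^ k * v := by nlinarith
      have hxp : 0 < 2 ^ k * v := by positivity
      have a1 := hy0 _ (le_trans (le_max_left _ _) hx)
      have hp1 := hS.pos _ hxp
      have hp2 := hS.pos (2 * (2 ^ k * v)) (by positivity)
      have a2 := Real.log_le_log (by positivity) a1.le
      rw [Real.log_div hp2.ne' hp1.ne', Real.log_rpow two_pos] at a2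
      rw [pow_succ, show (2:ℝ) ^ k * 2 * v = 2 * (2 ^ k * v) by ring]
      push_cast
      linarith
  have hlA : 0 ≤ Real.log A := Real.log_nonneg hA
  set k := ⌊2 / α * Real.log A / Real.log 2⌋₊ + 1 with hk
  have hk1 : (k:ℝ) ≤ 2 / α * Real.log A / Real.log 2 + 1 := by
    rw [hk]; push_cast
    have := Nat.floor_le (a := 2 / α * Real.log A / Real.log 2) (by positivity)
    linarith
  have hk2 : 2 / α * Real.log A / Real.log 2 < k := by
    rw [hk]; push_cast; exact Nat.lt_floor_add_one _
  rw [div_lt_iff₀ hl2] at hk2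
  have hk3 : (k:ℝ) * Real.log 2 ≤ 2 / α * Real.log A + Real.log 2 := by
    have := mul_le_mul_of_nonneg_right hk1 hl2.le
    rwa [add_mul, div_mul_cancel₀ _ hl2.ne', one_mul] at this
  have hlt : t < 2 ^ k * v := by
    by_contra hcon
    push Not at hcon
    have hxp : 0 < 2 ^ k * v := by positivity
    have b1 := hS.anti _ _ hxp hcon
    have b2 := Real.log_le_log (hS.pos _ ht) b1
    have b3 := Real.log_le_log (hS.pos _ hvp) hvt
    rw [Real.log_mul (by linarith) (hS.pos _ ht).ne'] at b3
    have b4 := hpow k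
    have b5 : Real.log A < k * (α / 2 * Real.log 2) := by
      have := mul_lt_mul_of_pos_left hk2 (by positivity : 0 < α / 2)
      have e : α / 2 * (2 / α * Real.log A) = Real.log A := by field_simp
      rw [e] at this
      linarith
    linarith
  have := Real.log_le_log ht hlt.le
  rw [Real.log_mul (by positivity) hvp.ne', Real.log_pow] at this
  linarith

lemma aux_trunc_nonneg {Ω : Type*} {Y : Ω → ℝ} (hYn : ∀ ω, 0 ≤ Y ω) (v : ℝ) (ω : Ω) :
    0 ≤ trunc Y v ω := by
  unfold trunc; split_ifs
  · exact hYn ω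
  · exact le_rfl

lemma aux_trunc_meas {Ω : Type*} [MeasurableSpace Ω] {Y : Ω → ℝ} (hY : Measurable Y) (v p : ℝ) :
    Measurable (fun ω => trunc Y v ω ^ p) := by
  unfold trunc
  exact (Measurable.ite (measurableSet_lt hY measurable_const) hY measurable_const).pow_const p

lemma aux_trunc_le {Ω : Type*} {Y : Ω → ℝ} (hYn : ∀ ω, 0 ≤ Y ω) {v p : ℝ} (hv : 0 < v) (hp : 0 < p)
    (ω : Ω) : ‖trunc Y v ω ^ p‖ ≤ v ^ p := by
  have h := aux_trunc_nonneg hYn v ω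
  rw [Real.norm_of_nonneg (by positivity)]
  apply Real.rpow_le_rpow h _ hp.le
  unfold trunc; split_ifs with h1
  · exact h1.le
  · exact hv.le

lemma AuxTail.lower_mean {S : ℝ → ℝ} {α : ℝ} (hS : AuxTail S α) (hα : 0 < α) {p : ℝ} (hp : 0 < p)
    {Ω : Type*} [MeasurableSpace Ω] (μ : Measure Ω) [IsProbabilityMeasure μ] :
    ∃ a x0 : ℝ, 0 < a ∧ 0 < x0 ∧ ∀ v, x0 ≤ v → ∀ Y : Ω → ℝ, Measurable Y → (∀ ω, 0 ≤ Y ω) →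
      (∀ x, 0 < x → (μ {ω | x < Y ω}).toReal = S x) →
      a * (v ^ p * S v) ≤ ∫ ω, trunc Y v ω ^ p ∂μ := by
  have h1 := (hS.rv (1 / 4) (by norm_num)).sub (hS.rv (1 / 2) (by norm_num))
  have hd : (0:ℝ) < (1 / 4) ^ (-α) - (1 / 2) ^ (-α) := by
    rw [sub_pos]
    exact Real.rpow_lt_rpow_of_neg (by norm_num) (by norm_num) (by linarith)
  set d := (1 / 4 : ℝ) ^ (-α) - (1 / 2) ^ (-α) with hdd
  obtain ⟨y0, hy0⟩ := eventually_atTop.1 (h1.eventually (lt_mem_nhds (half_lt_self hd)))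
  refine ⟨(1 / 4) ^ p * (d / 2), max y0 1, by positivity, lt_of_lt_of_le one_pos (le_max_right _ _), ?_⟩
  intro v hv Y hY hYn hYs
  have hv1 : 1 ≤ v := le_trans (le_max_right _ _) hv
  have hvp : 0 < v := by linarith
  have h2 := hy0 v (le_trans (le_max_left _ _) hv)
  have hSv := hS.pos v hvp
  rw [← sub_div, lt_div_iff₀ hSv] at h2
  have m1 : MeasurableSet {ω | 1 / 4 * v < Y ω} := measurableSet_lt measurable_const hY
  have m2 : MeasurableSet {ω | 1 / 2 * v < Y ω} := measurableSet_lt measurable_const hY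
  have e1 : ∫ ω, Set.indicator ({ω | 1 / 4 * v < Y ω} \ {ω | 1 / 2 * v < Y ω})
      (fun _ => (1 / 4 * v) ^ p) ω ∂μ ≤ ∫ ω, trunc Y v ω ^ p ∂μ := by
    apply integral_mono ((integrable_const _).indicator (m1.diff m2))
    · exact Integrable.of_bound (aux_trunc_meas hY v p).aestronglyMeasurable (v ^ p)
        (Eventually.of_forall fun ω => aux_trunc_le hYn hvp hp ω)
    intro ω
    have h := aux_trunc_nonneg hYn v ω
    dsimp only [Set.indicator]
    split_ifs with h3
    · simp only [Set.mem_sdiff, Set.mem_ofPred_eq, not_lt] at h3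
      apply Real.rpow_le_rpow (by positivity) _ hp.le
      unfold trunc
      rw [if_pos (by linarith [h3.2])]
      exact h3.1.le
    · positivity
  have hss : {ω | 1 / 2 * v < Y ω} ⊆ {ω | 1 / 4 * v < Y ω} := by
    intro ω h
    exact lt_of_le_of_lt (by linarith) (show 1 / 2 * v < Y ω from h)
  rw [integral_indicator_const _ (m1.diff m2), smul_eq_mul, measureReal_sdiff hss m2] at e1
  have e3 : μ.real {ω | 1 / 4 * v < Y ω} = S (1 / 4 * v) := hYs _ (by linarith)
  have e4 : μ.real {ω | 1 / 2 * v < Y ω} = S (1 / 2 * v) := hYs _ (by linarith)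
  rw [e3, e4, Real.mul_rpow (by norm_num) hvp.le] at e1
  have hpp : (0:ℝ) < (1 / 4) ^ p * v ^ p := by positivity
  have := mul_le_mul_of_nonneg_left h2.le hpp.le
  nlinarith

lemma aux_cheb {Ω : Type*} [MeasurableSpace Ω] (μ : Measure Ω) [IsProbabilityMeasure μ]
    (X : ℕ → Ω → ℝ) (hXmeas : ∀ i, Measurable (X i)) (hXnn : ∀ i ω, 0 ≤ X i ω)
    (v : ℕ → ℝ) (p : ℝ) (hp : 0 < p) (n : ℕ) (hn : 0 < n) (hv : 0 < v n) (m V : ℝ) (hm : 0 < m)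
    (hm1 : ∀ i, m ≤ ∫ ω, trunc (X i) (v n) ω ^ p ∂μ)
    (hV : ∀ i, ∫ ω, trunc (X i) (v n) ω ^ p * trunc (X i) (v n) ω ^ p ∂μ ≤ V) :
    μ.real {ω | ∑ i ∈ Finset.range n, trunc (X i) (v n) ω ^ p ≤ n * m / 2} ≤
      (n * V + covSum μ X v p n) / (n * m / 2) ^ 2 := by
  set U : ℕ → Ω → ℝ := fun i ω => trunc (X i) (v n) ω ^ p with hU
  have hLp : ∀ i, MemLp (U i) 2 μ := fun i =>
    MemLp.of_bound (aux_trunc_meas (hXmeas i) _ p).aestronglyMeasurable (v n ^ p)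
      (Eventually.of_forall fun ω => aux_trunc_le (hXnn i) hv hp ω)
  have hI : ∀ i, Integrable (U i) μ := fun i => (hLp i).integrable (by norm_num)
  have hcov : ∀ i j, ProbabilityTheory.covariance (U i) (U j) μ = cov μ (U i) (U j) := by
    intro i j
    rw [ProbabilityTheory.covariance_eq_sub (hLp i) (hLp j)]
    rfl
  have hvar : ProbabilityTheory.variance (∑ i ∈ Finset.range n, U i) μ
      ≤ n * V + covSum μ X v p n := by
    rw [ProbabilityTheory.variance_sum' (fun i _ => hLp i)]
    have : (n : ℝ) * V = ∑ i ∈ Finset.range n, V := by simp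
    rw [this, covSum, ← Finset.sum_add_distrib]
    apply Finset.sum_le_sum
    intro i hi
    have e1 : V = ∑ j ∈ Finset.range n, if i = j then V else 0 := by
      rw [Finset.sum_ite_eq, if_pos hi]
    rw [e1, ← Finset.sum_add_distrib]
    apply Finset.sum_le_sum
    intro j hj
    rw [hcov]
    split_ifs with h
    · subst h
      have := hV i
      have h2 := mul_self_nonneg (∫ ω, U i ω ∂μ)
      unfold cov
      simp only [hU] at *
      linarith
    · simp [hU]
  have hn' : (0:ℝ) < n := by exact_mod_cast hn
  have hc : 0 < n * m / 2 := by positivity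
  have hmean : (n:ℝ) * m ≤ ∫ ω, (∑ i ∈ Finset.range n, U i) ω ∂μ := by
    simp only [Finset.sum_apply]
    rw [integral_finsetSum _ (fun i _ => hI i)]
    have : (n : ℝ) * m = ∑ i ∈ Finset.range n, m := by simp
    rw [this]
    exact Finset.sum_le_sum fun i _ => hm1 i
  have hch := ProbabilityTheory.meas_ge_le_variance_div_sq
    (memLp_finsetSum' (Finset.range n) (fun i _ => hLp i)) hc
  have hsub : {ω | ∑ i ∈ Finset.range n, trunc (X i) (v n) ω ^ p ≤ n * m / 2} ⊆
      {ω | n * m / 2 ≤ |(∑ i ∈ Finset.range n, U i) ω - ∫ x, (∑ i ∈ Finset.range n, U i) x ∂μ|} := by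
    intro ω hω
    simp only [Set.mem_ofPred_eq] at hω ⊢
    rw [abs_sub_comm]
    refine le_trans ?_ (le_abs_self _)
    have : (∑ i ∈ Finset.range n, U i) ω ≤ n * m / 2 := by rw [Finset.sum_apply]; exact hω
    linarith
  refine (measureReal_mono hsub).trans ?_
  have h3 := ENNReal.toReal_mono ENNReal.ofReal_ne_top hch
  rw [ENNReal.toReal_ofReal (div_nonneg (ProbabilityTheory.variance_nonneg _ _) (by positivity))] at h3
  exact h3.trans (by gcongr)

lemma aux_markov {Ω : Type*} [MeasurableSpace Ω] (μ : Measure Ω) [IsProbabilityMeasure μ]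
    (X : ℕ → Ω → ℝ) (hXmeas : ∀ i, Measurable (X i)) (hXnn : ∀ i ω, 0 ≤ X i ω)
    (p : ℝ) (hp : 0 < p) (n : ℕ) (hn : 0 < n) (t : ℝ) (ht : 0 < t) (s G c : ℝ) (hc : 0 < c)
    (hG : 0 < G) (hs : ∀ i, (μ {ω | t < X i ω}).toReal = s)
    (hGi : ∀ i, ∫ ω, (if X i ω ≤ t then X i ω ^ p else 0) ∂μ ≤ G) :
    μ.real {ω | c * (n * G) ≤ ∑ i ∈ Finset.range n, X i ω ^ p} ≤ n * s + 1 / c := by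
  have hn' : (0:ℝ) < n := by exact_mod_cast hn
  set W : ℕ → Ω → ℝ := fun i ω => if X i ω ≤ t then X i ω ^ p else 0 with hW
  have hWn : ∀ i ω, 0 ≤ W i ω := by
    intro i ω
    have := hXnn i ω
    simp only [hW]; split_ifs <;> positivity
  have hint : ∀ i, Integrable (W i) μ := by
    intro i
    refine Integrable.of_bound (C := t ^ p) ?_ ?_
    · exact (Measurable.ite (measurableSet_le (hXmeas i) measurable_const) ((hXmeas i).pow_const p)
        measurable_const).aestronglyMeasurable
    · refine Eventually.of_forall fun ω => ?_
      rw [Real.norm_of_nonneg (hWn i ω)]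
      simp only [hW]
      split_ifs with h
      · exact Real.rpow_le_rpow (hXnn i ω) h hp.le
      · positivity
  have hsub : {ω | c * (n * G) ≤ ∑ i ∈ Finset.range n, X i ω ^ p} ⊆
      (⋃ i ∈ Finset.range n, {ω | t < X i ω}) ∪
        {ω | c * (n * G) ≤ ∑ i ∈ Finset.range n, W i ω} := by
    intro ω hω
    by_cases h : ∃ i ∈ Finset.range n, t < X i ω
    · left
      simpa using h
    · right
      push Not at h
      simp only [Set.mem_ofPred_eq] at hω ⊢
      refine hω.trans (le_of_eq (Finset.sum_congr rfl fun i hi => ?_))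
      simp only [hW]; rw [if_pos (h i hi)]
  refine (measureReal_mono hsub).trans ((measureReal_union_le _ _).trans (add_le_add ?_ ?_))
  · refine (measureReal_biUnion_finset_le _ _).trans ?_
    have : ∀ i ∈ Finset.range n, μ.real {ω | t < X i ω} = s := fun i _ => hs i
    rw [Finset.sum_congr rfl this]
    simp
  · have h1 := mul_meas_ge_le_integral_of_nonneg (μ := μ) (f := fun ω => ∑ i ∈ Finset.range n, W i ω)
      (Eventually.of_forall fun ω => Finset.sum_nonneg fun i _ => hWn i ω)
      (integrable_finsetSum _ fun i _ => hint i) (c * (n * G))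
    rw [integral_finsetSum _ (fun i _ => hint i)] at h1
    have h2 : ∑ i ∈ Finset.range n, ∫ ω, W i ω ∂μ ≤ n * G := by
      have : (n : ℝ) * G = ∑ i ∈ Finset.range n, G := by simp
      rw [this]
      exact Finset.sum_le_sum fun i _ => hGi i
    rw [le_div_iff₀ hc]
    have h3 : 0 < n * G := by positivity
    have h4 := h1.trans h2
    have h5 : (n * G) * (μ.real {ω | c * (n * G) ≤ ∑ i ∈ Finset.range n, W i ω} * c) ≤ (n * G) * 1 := by
      nlinarith
    exact le_of_mul_le_mul_left h5 h3

set_option maxHeartbeats 1000000 in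
lemma aux_log (α p K a N c t v lt St Sv Q : ℝ) (hα : 0 < α) (hp : 0 < p) (hK : 0 < K) (ha : 0 < a)
    (hN : 1 < N) (hc : 0 < c) (hc1 : 1 ≤ Real.log c) (ht : 0 < t) (hv : 0 < v) (hlt : 0 < lt)
    (hSt : St = t ^ (-α) * lt) (hSv : 0 < Sv)
    (h1 : 1 / 2 ≤ N * c * St) (h2 : N * c * St ≤ 2) (h3 : 1 / 2 ≤ N * Sv / c)
    (hpot : Real.log t ≤ Real.log v + 2 / α * Real.log (4 * c ^ 2) + 2 * Real.log 2)
    (hQ1 : N * (a * (v ^ p * Sv)) / 2 < Q) (hQ2 : Q < c * (N * (K * (t ^ p * St)))) :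
    |Real.log (N⁻¹ * Q) / Real.log N - (p - α) / α| ≤
      (|Real.log K| + |Real.log (a / 2)| + 10 * (p / α) + 2 * p + 2) *
        ((Real.log c + |Real.log lt|) / Real.log N) := by
  have hN0 : 0 < N := by linarith
  have hL : 0 < Real.log N := Real.log_pos hN
  have hStp : 0 < St := by rw [hSt]; positivity
  have l2 : Real.log 2 ≤ 1 := by have := Real.log_two_lt_d9; linarith
  have l2p : 0 < Real.log 2 := Real.log_pos one_lt_two
  have hhalf : Real.log (1 / 2) = - Real.log 2 := by rw [one_div, Real.log_inv]
  have hlS : Real.log St = -α * Real.log t + Real.log lt := by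
    rw [hSt, Real.log_mul (by positivity) hlt.ne', Real.log_rpow ht]
  have g1 := Real.log_le_log (by norm_num) h1
  have g2 := Real.log_le_log (by positivity) h2
  have g3 := Real.log_le_log (by norm_num) h3
  rw [Real.log_mul (by positivity) hStp.ne', Real.log_mul hN0.ne' hc.ne'] at g1 g2
  rw [Real.log_div (by positivity) hc.ne', Real.log_mul hN0.ne' hSv.ne'] at g3
  have g4 : Real.log (4 * c ^ 2) = 2 * Real.log 2 + 2 * Real.log c := by
    rw [Real.log_mul (by norm_num) (by positivity), Real.log_pow,
      show (4:ℝ) = 2 ^ 2 by norm_num, Real.log_pow]; norm_num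
  rw [g4] at hpot
  have hQ : 0 < Q := lt_trans (by positivity) hQ1
  have u1 : a / 2 * (v ^ p * Sv) ≤ N⁻¹ * Q := by
    rw [inv_mul_eq_div, le_div_iff₀ hN0]; nlinarith
  have u2 : N⁻¹ * Q ≤ c * (K * (t ^ p * St)) := by
    rw [inv_mul_eq_div, div_le_iff₀ hN0]; nlinarith
  have w1 := Real.log_le_log (by positivity) u1
  have w2 := Real.log_le_log (by positivity) u2
  rw [Real.log_mul (by positivity) (by positivity), Real.log_mul (by positivity) hSv.ne',
    Real.log_rpow hv] at w1
  rw [Real.log_mul hc.ne' (by positivity), Real.log_mul hK.ne' (by positivity),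
    Real.log_mul (by positivity) hStp.ne', Real.log_rpow ht] at w2
  set M := Real.log (N⁻¹ * Q)
  set L := Real.log N
  have e : M / L - (p - α) / α = (M - (p / α - 1) * L) / L := by field_simp
  rw [e, abs_div, abs_of_pos hL, mul_div_assoc', div_le_div_iff_of_pos_right hL]
  -- set up
  set k := p / α with hk
  have hkp : 0 < k := by positivity
  have hkα : p = k * α := by rw [hk]; field_simp
  set x := Real.log lt
  set y := Real.log c
  have b1 := le_abs_self x
  have b2 := neg_abs_le x
  have b3 := abs_nonneg x
  have t1 : p * Real.log t ≤ k * (L + y + |x| + 1) := by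
    rw [hkα, mul_assoc]; apply mul_le_mul_of_nonneg_left _ hkp.le; linarith
  have t2 : k * (L + y - |x| - 1) ≤ p * Real.log t := by
    rw [hkα, mul_assoc]; apply mul_le_mul_of_nonneg_left _ hkp.le; linarith
  have t3 : p * Real.log t ≤ p * Real.log v + k * (4 * Real.log 2 + 4 * y) + 2 * p * Real.log 2 := by
    have := mul_le_mul_of_nonneg_left hpot hp.le
    have e : p * (2 / α) = 2 * k := by rw [hk]; ring
    have e2 : p * (Real.log v + 2 / α * (2 * Real.log 2 + 2 * y) + 2 * Real.log 2)
      = p * Real.log v + p * (2 / α) * (2 * Real.log 2 + 2 * y) + 2 * p * Real.log 2 := by ring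
    rw [e2, e] at this
    linarith
  have c1 := le_abs_self (Real.log K)
  have c2 := neg_abs_le (Real.log (a / 2))
  have c3 := abs_nonneg (Real.log K)
  have c4 := abs_nonneg (Real.log (a / 2))
  have d1 : |Real.log K| ≤ |Real.log K| * (y + |x|) := by nlinarith
  have d2 : |Real.log (a / 2)| ≤ |Real.log (a / 2)| * (y + |x|) := by nlinarith
  have d3 : k ≤ k * y := by nlinarith
  have d4 : p ≤ p * y := by nlinarith
  have d5 : 0 ≤ k * |x| := by positivity
  have d6 : 0 ≤ p * |x| := by positivity
  have d7 : k * Real.log 2 ≤ k := by nlinarith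
  have d8 : p * Real.log 2 ≤ p := by nlinarith
  have hC : (|Real.log K| + |Real.log (a / 2)| + 10 * k + 2 * p + 2) * (y + |x|) = |Real.log K| * (y + |x|) + |Real.log (a / 2)| * (y + |x|)
    + 10 * (k * y) + 10 * (k * |x|) + 2 * (p * y) + 2 * (p * |x|) + 2 * (y + |x|) := by ring
  rw [hC, abs_le]
  constructor <;> linarith

set_option maxHeartbeats 4000000 in
/-- **Lemma (rate for `log M_{n,p} / log n`).**
Under Condition A(p) with `p > α`,
`log M_{n,p}/log n − (p−α)/α = O_p((log c_n + |log l(t_n)|)/log n)`, and consequently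
`log M_{n,p}/log n → (p−α)/α` in probability. -/
theorem log_sampleMoment_rate
    {Ω : Type*} [MeasurableSpace Ω] (μ : Measure Ω) [IsProbabilityMeasure μ]
    (X : ℕ → Ω → ℝ) (hXmeas : ∀ i, Measurable (X i)) (hXnn : ∀ i ω, 0 ≤ X i ω)
    (α : ℝ) (hα : 0 < α)
    (l : ℝ → ℝ) (hlpos : ∀ x : ℝ, 0 < x → 0 < l x) (hl : SlowlyVarying l)
    (hsurv : ∀ i, ∀ x : ℝ, 0 < x → (μ {ω | x < X i ω}).toReal = x ^ (-α) * l x)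
    (c : ℕ → ℝ) (hc : ∀ n, 0 < c n) (hctop : Tendsto c atTop atTop)
    (hncmono : Monotone fun n : ℕ => (n : ℝ) * c n)
    (hnctop : Tendsto (fun n : ℕ => (n : ℝ) * c n) atTop atTop)
    (hclog : Tendsto (fun n : ℕ => Real.log (c n) / Real.log n) atTop (nhds 0))
    (t : ℕ → ℝ) (htpos : ∀ n, 0 < t n)
    (ht : Tendsto (fun n : ℕ => (n : ℝ) * c n * l (t n) / t n ^ α) atTop (nhds 1))
    (v : ℕ → ℝ) (hvpos : ∀ n, 0 < v n)
    (hv : Tendsto (fun n : ℕ => (n : ℝ) * l (v n) / (v n ^ α * c n)) atTop (nhds 1))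
    (p : ℝ) (hp : α < p)
    (hA : ConditionA μ X v c p) :
    IsOp μ (fun n ω => Real.log (sampleMoment X p n ω) / Real.log n - (p - α) / α)
      (fun n => (Real.log (c n) + |Real.log (l (t n))|) / Real.log n) ∧
    TendstoInProbability μ
      (fun n ω => Real.log (sampleMoment X p n ω) / Real.log n) ((p - α) / α) := by
  have hp0 : 0 < p := hα.trans hp
  set S : ℝ → ℝ := fun x => x ^ (-α) * l x with hSdef
  have hS : AuxTail S α := by
    refine ⟨fun x hx => ?_, fun x y hx hxy => ?_, fun lam hlam => ?_⟩
    · have := hlpos x hx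
      simp only [hSdef]; positivity
    · simp only [hSdef]
      rw [← hsurv 0 x hx, ← hsurv 0 y (hx.trans_le hxy)]
      refine measureReal_mono ?_ (measure_ne_top _ _)
      intro ω h
      exact lt_of_le_of_lt hxy (show y < X 0 ω from h)
    · have h1 := (hl lam hlam).const_mul (lam ^ (-α))
      rw [mul_one] at h1
      refine h1.congr' ?_
      filter_upwards [eventually_gt_atTop 0] with x hx
      simp only [hSdef]
      rw [Real.mul_rpow hlam.le hx.le]
      have := hlpos x hx
      have : 0 < x ^ (-α) := by positivity
      field_simp
  have hNS : ∀ i, ∀ x, 0 < x → (μ {ω | x < X i ω}).toReal = S x := hsurv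
  -- normalisations
  have htS : Tendsto (fun n : ℕ => (n:ℝ) * c n * S (t n)) atTop (nhds 1) := by
    refine ht.congr fun n => ?_
    simp only [hSdef]
    rw [Real.rpow_neg (htpos n).le]; ring
  have hvS : Tendsto (fun n : ℕ => (n:ℝ) * S (v n) / c n) atTop (nhds 1) := by
    refine hv.congr fun n => ?_
    simp only [hSdef]
    rw [Real.rpow_neg (hvpos n).le]
    have := hc n
    have : 0 < v n ^ α := Real.rpow_pos_of_pos (hvpos n) _
    field_simp
  have hlogn : Tendsto (fun n : ℕ => Real.log n) atTop atTop :=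
    Real.tendsto_log_atTop.comp tendsto_natCast_atTop_atTop
  have hlc : Tendsto (fun n => Real.log (c n)) atTop atTop := Real.tendsto_log_atTop.comp hctop
  -- c n / n → 0
  have hcn : Tendsto (fun n : ℕ => c n / n) atTop (nhds 0) := by
    have h1 : Tendsto (fun n : ℕ => Real.log n * (Real.log (c n) / Real.log n - 1)) atTop atBot := by
      have := hclog.sub_const 1
      exact hlogn.atTop_mul_neg (by norm_num) this
    have h2 := Real.tendsto_exp_atBot.comp h1
    refine h2.congr' ?_
    filter_upwards [eventually_gt_atTop 1] with n hn
    have hn' : (1:ℝ) < n := by exact_mod_cast hn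
    have hL := Real.log_pos hn'
    have e : Real.log n * (Real.log (c n) / Real.log n - 1) = Real.log (c n) - Real.log n := by
      field_simp
    simp only [Function.comp]
    rw [e, Real.exp_sub, Real.exp_log (hc n), Real.exp_log (by linarith)]
  have hSv0 : Tendsto (fun n => S (v n)) atTop (nhds 0) := by
    have := hvS.mul hcn
    rw [mul_zero] at this
    refine this.congr' ?_
    filter_upwards [eventually_gt_atTop 0] with n hn
    have hn' : (0:ℝ) < n := by exact_mod_cast hn
    have := hc n
    field_simp
  have hSt0 : Tendsto (fun n => S (t n)) atTop (nhds 0) := by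
    have := htS.mul hnctop.inv_tendsto_atTop
    rw [mul_zero] at this
    refine this.congr' ?_
    filter_upwards [eventually_gt_atTop 0] with n hn
    have hn' : (0:ℝ) < n := by exact_mod_cast hn
    have := hc n
    simp only [Pi.inv_apply]
    field_simp
  have hvtop := hS.tendsto_arg v hvpos hSv0
  have httop := hS.tendsto_arg t htpos hSt0
  obtain ⟨K, xK, hK, hxK, hkar⟩ := hS.karamata hα hp μ
  obtain ⟨K2, xK2, hK2, hxK2, hkar2⟩ := hS.karamata hα (show α < 2 * p by linarith) μ
  obtain ⟨a, xa, ha, hxa, hlow⟩ := hS.lower_mean hα hp0 μ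
  obtain ⟨xp, hxp, hpot⟩ := hS.potter hα
  set C := (|Real.log K| + |Real.log (a / 2)| + 10 * (p / α) + 2 * p + 2) with hC
  have hCp : 0 < C := by positivity
  set r : ℕ → ℝ := fun n => (Real.log (c n) + |Real.log (l (t n))|) / Real.log n with hr
  -- main probability estimate
  have hmain : Tendsto (fun n : ℕ => (μ {ω | C * r n <
      |Real.log (sampleMoment X p n ω) / Real.log n - (p - α) / α|}).toReal) atTop (nhds 0) := by
    set cs : ℕ → ℝ := fun n => covSum μ X v p n / (v n ^ (2 * p) * c n ^ 2) with hcs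
    have hbound : Tendsto (fun n : ℕ => 16 / a ^ 2 * (2 * K2 * (c n)⁻¹ + cs n)
        + (2 * (c n)⁻¹ + (c n)⁻¹)) atTop (nhds 0) := by
      have hci := hctop.inv_tendsto_atTop
      have := (((hci.const_mul (2 * K2)).add hA).const_mul (16 / a ^ 2)).add
        ((hci.const_mul 2).add hci)
      simpa using this
    refine squeeze_zero' (Eventually.of_forall fun n => ENNReal.toReal_nonneg) ?_ hbound
    filter_upwards [htS.eventually (Icc_mem_nhds (by norm_num : (1/2:ℝ) < 1) (by norm_num : (1:ℝ) < 2)),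
      hvS.eventually (Icc_mem_nhds (by norm_num : (1/2:ℝ) < 1) (by norm_num : (1:ℝ) < 2)),
      eventually_gt_atTop 1, hlc.eventually_ge_atTop 1, hctop.eventually_ge_atTop 1,
      httop.eventually_ge_atTop xK, hvtop.eventually_ge_atTop xK2,
      hvtop.eventually_ge_atTop xa, hvtop.eventually_ge_atTop xp]
      with n h1 h2 hn hlcn hcn1 htK hvK hva hvxp
    obtain ⟨h1a, h1b⟩ := h1
    obtain ⟨h2a, h2b⟩ := h2
    have hn' : (1:ℝ) < n := by exact_mod_cast hn
    have hn0 : (0:ℝ) < n := by linarith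
    have hcp := hc n
    have htp := htpos n
    have hvp := hvpos n
    have hSt := hS.pos _ htp
    have hSv := hS.pos _ hvp
    set m := a * (v n ^ p * S (v n)) with hm
    set G := K * (t n ^ p * S (t n)) with hG
    have hmp : 0 < m := by positivity
    have hGp : 0 < G := by positivity
    have hI2 : ∀ i, ∫ ω, trunc (X i) (v n) ω ^ p * trunc (X i) (v n) ω ^ p ∂μ
        ≤ K2 * (v n ^ (2 * p) * S (v n)) := by
      intro i
      refine le_trans ?_ (hkar2 (v n) hvK (X i) (hXmeas i) (hXnn i) (hNS i))
      have hpt : ∀ ω, trunc (X i) (v n) ω ^ p * trunc (X i) (v n) ω ^ p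
          = trunc (X i) (v n) ω ^ (2 * p) := by
        intro ω
        rw [two_mul, Real.rpow_add_of_nonneg (aux_trunc_nonneg (hXnn i) _ ω) hp0.le hp0.le]
      simp only [hpt]
      apply integral_mono
      · exact Integrable.of_bound (aux_trunc_meas (hXmeas i) _ _).aestronglyMeasurable (v n ^ (2 * p))
          (Eventually.of_forall fun ω => aux_trunc_le (hXnn i) hvp (by linarith) ω)
      · refine Integrable.of_bound (C := v n ^ (2 * p)) ?_ ?_
        · exact (Measurable.ite (measurableSet_le (hXmeas i) measurable_const)
            ((hXmeas i).pow_const _) measurable_const).aestronglyMeasurable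
        · refine Eventually.of_forall fun ω => ?_
          have := hXnn i ω
          split_ifs with h
          · rw [Real.norm_of_nonneg (by positivity)]
            exact Real.rpow_le_rpow this h (by linarith)
          · simp; positivity
      · intro ω
        have := hXnn i ω
        dsimp only [trunc]
        split_ifs with h3 h4 h4
        · exact le_rfl
        · exact absurd h3.le h4
        · rw [Real.zero_rpow (by linarith)]; positivity
        · rw [Real.zero_rpow (by linarith)]
    have hch := aux_cheb μ X hXmeas hXnn v p hp0 n (by omega) hvp m _ hmp
      (fun i => hlow (v n) hva (X i) (hXmeas i) (hXnn i) (hNS i)) hI2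
    have hmk := aux_markov μ X hXmeas hXnn p hp0 n (by omega) (t n) htp (S (t n)) G (c n) hcp hGp
      (fun i => hNS i _ htp) (fun i => hkar (t n) htK (X i) (hXmeas i) (hXnn i) (hNS i))
    have hsub : {ω | C * r n < |Real.log (sampleMoment X p n ω) / Real.log n - (p - α) / α|} ⊆
        {ω | ∑ i ∈ Finset.range n, trunc (X i) (v n) ω ^ p ≤ n * m / 2} ∪
        {ω | c n * (n * G) ≤ ∑ i ∈ Finset.range n, X i ω ^ p} := by
      intro ω hω
      by_contra hcon
      simp only [Set.mem_union, Set.mem_ofPred_eq, not_or, not_le] at hcon hω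
      obtain ⟨hq1, hq2⟩ := hcon
      have hle : ∑ i ∈ Finset.range n, trunc (X i) (v n) ω ^ p ≤ ∑ i ∈ Finset.range n, X i ω ^ p := by
        apply Finset.sum_le_sum
        intro i _
        apply Real.rpow_le_rpow (aux_trunc_nonneg (hXnn i) _ ω) _ hp0.le
        unfold trunc
        split_ifs
        · exact le_rfl
        · exact hXnn i ω
      have hpt := hpot (v n) (t n) (4 * c n ^ 2) hvxp htp (by nlinarith) (by
        rw [div_le_iff₀ hcp] at h2b
        have z1 : n * S (v n) ≤ n * (4 * c n ^ 2 * S (t n)) := by nlinarith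
        exact le_of_mul_le_mul_left z1 hn0)
      have := aux_log α p K a n (c n) (t n) (v n) (l (t n)) (S (t n)) (S (v n))
        (∑ i ∈ Finset.range n, X i ω ^ p) hα hp0 hK ha hn' hcp hlcn htp hvp (hlpos _ htp) rfl hSv
        h1a h1b h2a hpt (hq1.trans_le hle) hq2
      exact absurd hω (not_lt.2 this)
    refine (measureReal_mono hsub (measure_ne_top _ _)).trans ((measureReal_union_le _ _).trans (add_le_add ?_ ?_))
    · refine hch.trans ?_
      have hvv : v n ^ (2 * p) = v n ^ p * v n ^ p := by
        rw [two_mul, Real.rpow_add hvp]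
      have hvq : 0 < v n ^ p := by positivity
      rw [div_le_iff₀ hcp] at h2b
      rw [le_div_iff₀ hcp] at h2a
      have hnum : n * (K2 * (v n ^ (2 * p) * S (v n))) + covSum μ X v p n ≤
          (v n ^ (2 * p) * c n ^ 2) * (2 * K2 * (c n)⁻¹ + cs n) := by
        have z1 : (v n ^ (2 * p) * c n ^ 2) * (2 * K2 * (c n)⁻¹ + cs n)
          = K2 * v n ^ (2 * p) * (2 * c n) + covSum μ X v p n := by
          simp only [hcs]; field_simp
        rw [z1]
        have : K2 * v n ^ (2 * p) * (n * S (v n)) ≤ K2 * v n ^ (2 * p) * (2 * c n) :=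
          mul_le_mul_of_nonneg_left h2b (by positivity)
        linarith
      have hnn : 0 ≤ (v n ^ (2 * p) * c n ^ 2) * (2 * K2 * (c n)⁻¹ + cs n) := by
        by_contra hneg
        push Not at hneg
        have z := hch.trans (div_le_div_of_nonneg_right hnum (sq_nonneg _))
        have z2 : (v n ^ (2 * p) * c n ^ 2) * (2 * K2 * (c n)⁻¹ + cs n) / (n * m / 2) ^ 2 < 0 :=
          div_neg_of_neg_of_pos hneg (by positivity)
        have z3 := measureReal_nonneg (μ := μ)
          (s := {ω | ∑ i ∈ Finset.range n, trunc (X i) (v n) ω ^ p ≤ n * m / 2})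
        linarith
      have hden : a * v n ^ p * c n / 4 ≤ n * m / 2 := by
        have : a * v n ^ p * (1 / 2 * c n) ≤ a * v n ^ p * (n * S (v n)) :=
          mul_le_mul_of_nonneg_left h2a (by positivity)
        rw [hm]; linarith
      calc _ ≤ (v n ^ (2 * p) * c n ^ 2) * (2 * K2 * (c n)⁻¹ + cs n) / (n * m / 2) ^ 2 :=
            div_le_div_of_nonneg_right hnum (sq_nonneg _)
        _ ≤ (v n ^ (2 * p) * c n ^ 2) * (2 * K2 * (c n)⁻¹ + cs n) / (a * v n ^ p * c n / 4) ^ 2 := by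
            apply div_le_div_of_nonneg_left hnn (by positivity)
            exact pow_le_pow_left₀ (by positivity) hden 2
        _ = _ := by
            generalize (2 * K2 * (c n)⁻¹ + cs n) = w
            rw [hvv]; field_simp; norm_num
    · refine hmk.trans ?_
      have : (n:ℝ) * S (t n) ≤ 2 * (c n)⁻¹ := by
        rw [← div_eq_mul_inv, le_div_iff₀ hcp]; linarith
      rw [one_div]; linarith
  -- the rate tends to zero
  have hr0 : Tendsto r atTop (nhds 0) := by
    have h1 := (hS.log_tail hα).comp httop
    -- log (l t) / log t → 0
    have h2 : Tendsto (fun n => Real.log (l (t n)) / Real.log (t n)) atTop (nhds 0) := by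
      refine h1.congr fun n => ?_
      simp only [Function.comp, hSdef]
      rw [Real.log_mul (Real.rpow_pos_of_pos (htpos n) _).ne' (hlpos _ (htpos n)).ne',
        Real.log_rpow (htpos n)]
      congr 1; ring
    have hlt : ∀ᶠ n in atTop, 0 < Real.log (t n) :=
      (Real.tendsto_log_atTop.comp httop).eventually_gt_atTop 0
    -- eventually log t ≤ (4/α) log n
    have h3 : ∀ᶠ n : ℕ in atTop, Real.log (t n) ≤ 6 / α * Real.log n := by
      filter_upwards [h2.eventually (gt_mem_nhds (by positivity : 0 < α / 2)), hlt,
        htS.eventually (Icc_mem_nhds (by norm_num : (1/2:ℝ) < 1) (by norm_num : (1:ℝ) < 2)),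
        hclog.eventually (gt_mem_nhds one_pos), hlogn.eventually_ge_atTop 1, eventually_gt_atTop 0]
        with n q1 q2 q3 q4 q5 hn
      have hn' : (0:ℝ) < n := by exact_mod_cast hn
      have hSt := hS.pos _ (htpos n)
      have hcp := hc n
      rw [div_lt_iff₀ q2] at q1
      rw [div_lt_iff₀ (by linarith)] at q4
      have g1 := Real.log_le_log (by norm_num) q3.1
      rw [Real.log_mul (by positivity) hSt.ne', Real.log_mul hn'.ne' hcp.ne', one_div,
        Real.log_inv] at g1
      have g2 : Real.log (S (t n)) = -α * Real.log (t n) + Real.log (l (t n)) := by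
        simp only [hSdef]
        rw [Real.log_mul (Real.rpow_pos_of_pos (htpos n) _).ne' (hlpos _ (htpos n)).ne',
          Real.log_rpow (htpos n)]
      have l2 : Real.log 2 ≤ 1 := by have := Real.log_two_lt_d9; linarith
      rw [div_mul_eq_mul_div, le_div_iff₀ hα]
      linarith
    have h4 : Tendsto (fun n : ℕ => |Real.log (l (t n))| / Real.log n) atTop (nhds 0) := by
      have h5 : Tendsto (fun n => 6 / α * |Real.log (l (t n)) / Real.log (t n)|) atTop (nhds 0) := by
        simpa using h2.abs.const_mul (6 / α)
      refine squeeze_zero' ?_ ?_ h5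
      · filter_upwards [hlogn.eventually_ge_atTop 1] with n hn
        positivity
      · filter_upwards [hlogn.eventually_ge_atTop 1, h3, hlt] with n q1 q2 q3
        rw [abs_div, abs_of_pos q3, div_le_iff₀ (by linarith)]
        have e : 6 / α * (|Real.log (l (t n))| / Real.log (t n)) * Real.log n
          = |Real.log (l (t n))| * (6 / α * Real.log n / Real.log (t n)) := by ring
        rw [e]
        apply le_mul_of_one_le_right (abs_nonneg _)
        rw [one_le_div q3]; exact q2
    have := hclog.add h4
    rw [add_zero] at this
    refine this.congr fun n => ?_
    simp only [hr]; ring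
  refine ⟨fun ε hε => ⟨C, hCp, hmain.eventually (gt_mem_nhds hε)⟩, fun ε hε => ?_⟩
  refine squeeze_zero' (Eventually.of_forall fun n => ENNReal.toReal_nonneg) ?_ hmain
  have h1 : Tendsto (fun n => C * r n) atTop (nhds 0) := by simpa using hr0.const_mul C
  filter_upwards [h1.eventually (gt_mem_nhds hε)] with n hn
  refine measureReal_mono ?_ (measure_ne_top _ _)
  intro ω hω
  exact lt_trans hn hω
end
end
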